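/- Let n ≥ 2 and w ≥ 1, let ε ∈ (0,1), and let r ≥ 1 be a real number with e·r/n ≤ 1/2 such that for every ℓ with 1 ≤ ℓ ≤ 2w, every family of ℓ-matchings in K_{n,n} of size greater than r^ℓ contains an ε-matching sunflower. Suppose a monotone circuit of size s on the n² input bits indexed by L × R outputs 1 on every perfect matching of K_{n,n} and outputs 0 on x(c) for every colouring c with an odd number of vertices coloured 1. Then there exists a finite family G of matchings, each of size at most w, with at most r^ℓ many ℓ-matchings in G for every ℓ ≥ 1, such that (1/2)·Pr_{c}[F_G(x(c)) = 1] + (1/2)·Pr_{P}[F_G(P) = 0] ≤ s · (2·n^{4w}·ε + 2·(e·r/n)^w), where c is sampled uniformly among colourings with an odd number of vertices coloured 1 and P is sampled uniformly among perfect matchings of K_{n,n} (viewed as graphs). -/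

import Mathlib

/-- A monotone circuit (straight-line program) with input bits indexed by `ι`:
gate `i` is either an input variable, or the AND (`true`) / OR (`false`) of two
earlier gates. Its size is the number of gates. -/
structure MonCircuit (ι : Type) where
  size : ℕ
  gate : (i : Fin size) → ι ⊕ (Bool × Fin i.val × Fin i.val)

/-- Evaluation of the gates of a monotone circuit on input `x`. -/
def MonCircuit.eval {ι : Type} (C : MonCircuit ι) (x : ι → Bool) : (i : Fin C.size) → Bool
  | i =>
    match C.gate i with
    | Sum.inl j => x j
    | Sum.inr (op, j, k) =>
      let a := C.eval x ⟨j.val, j.isLt.trans i.isLt⟩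
      let b := C.eval x ⟨k.val, k.isLt.trans i.isLt⟩
      if op then a && b else a || b
  termination_by i => i.val

/-- `C` computes the boolean function `f` (given as a predicate on inputs):
the circuit is nonempty and its last gate outputs `true` exactly on inputs satisfying `f`. -/
def MonCircuit.Computes {ι : Type} (C : MonCircuit ι) (f : (ι → Bool) → Prop) : Prop :=
  ∃ h : 0 < C.size, ∀ x : ι → Bool,
    (C.eval x ⟨C.size - 1, Nat.sub_lt h Nat.one_pos⟩ = true ↔ f x)

/-- A matching in `K_{n,n}`: a set of edges with pairwise distinct left endpoints
and pairwise distinct right endpoints. -/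
def IsMatching {n : ℕ} (M : Finset (Fin n × Fin n)) : Prop :=
  ∀ e ∈ M, ∀ e' ∈ M, e ≠ e' → e.1 ≠ e'.1 ∧ e.2 ≠ e'.2

/-- A colouring of the vertices `L ⊕ R` of `K_{n,n}` with an odd number of `1`s. -/
def OddColouring {n : ℕ} (c : Fin n ⊕ Fin n → Bool) : Prop :=
  Odd (Nat.card {v : Fin n ⊕ Fin n // c v = true})

/-- A family `M'` of `ℓ`-matchings with `|M'| ≥ 2` and core `K = ⋂ M'` is an `ε`-matching
sunflower if for `c` sampled uniformly among colourings of `L ⊕ R` with an odd number of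
vertices coloured 1, the probability that some `M ∈ M'` has every edge of `M \ K`
monochromatic under `c` is at least `1 - ε`. -/
def IsMatchingSunflower (n : ℕ) (ε : ℝ) (𝓜' : Finset (Finset (Fin n × Fin n))) : Prop :=
  2 ≤ 𝓜'.card ∧
  1 - ε ≤
    (Nat.card {c : Fin n ⊕ Fin n → Bool // OddColouring c ∧
        ∃ M ∈ 𝓜', ∀ e ∈ M \ 𝓜'.inf id, c (Sum.inl e.1) = c (Sum.inr e.2)} : ℝ) /
      (Nat.card {c : Fin n ⊕ Fin n → Bool // OddColouring c} : ℝ)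

/-- `x(c)`: the bipartite graph consisting of all edges monochromatic under the colouring `c`. -/
def graphOf {n : ℕ} (c : Fin n ⊕ Fin n → Bool) : Finset (Fin n × Fin n) :=
  Finset.univ.filter (fun e : Fin n × Fin n => c (Sum.inl e.1) = c (Sum.inr e.2))

open Finset

/-- The odd colourings of `K_{n,n}`, as a finset. -/
noncomputable def oddColourings (n : ℕ) : Finset (Fin n ⊕ Fin n → Bool) :=
  open Classical in univ.filter OddColouring

/-- The perfect matchings of `K_{n,n}`, as a finset. -/
noncomputable def perfectMatchings (n : ℕ) : Finset (Finset (Fin n × Fin n)) :=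
  open Classical in univ.filter fun P => IsMatching P ∧ P.card = n

/-- The monotone DNF with terms `𝓖` accepts the graph `x`. -/
def Accepts {n : ℕ} (𝓖 : Finset (Finset (Fin n × Fin n))) (x : Finset (Fin n × Fin n)) : Prop :=
  ∃ M ∈ 𝓖, M ⊆ x

theorem mem_oddColourings {n : ℕ} {c : Fin n ⊕ Fin n → Bool} :
    c ∈ oddColourings n ↔ OddColouring c := by
  simp [oddColourings]

theorem mem_perfectMatchings {n : ℕ} {P : Finset (Fin n × Fin n)} :
    P ∈ perfectMatchings n ↔ IsMatching P ∧ P.card = n := by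
  simp [perfectMatchings]

theorem natCard_oddColouring (n : ℕ) :
    Nat.card {c : Fin n ⊕ Fin n → Bool // OddColouring c} = (oddColourings n).card := by
  classical
  rw [Nat.card_eq_fintype_card, Fintype.card_subtype, oddColourings]

theorem natCard_perfectMatching (n : ℕ) :
    Nat.card {P : Finset (Fin n × Fin n) // IsMatching P ∧ P.card = n} =
      (perfectMatchings n).card := by
  classical
  rw [Nat.card_eq_fintype_card, Fintype.card_subtype, perfectMatchings]

theorem natCard_subtype_le_card {α : Type*} [Fintype α] {p : α → Prop} {s : Finset α}
    (h : ∀ a, p a → a ∈ s) : Nat.card {a // p a} ≤ s.card := by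
  classical
  rw [Nat.card_eq_fintype_card, Fintype.card_subtype]
  exact card_le_card fun a ha => h a (by simpa using ha)

theorem IsMatching.subset {n : ℕ} {M K : Finset (Fin n × Fin n)} (hM : IsMatching M)
    (hK : K ⊆ M) : IsMatching K :=
  fun e he f hf => hM e (hK he) f (hK hf)

/-- The graph of a permutation, viewed as a set of edges of `K_{n,n}`. -/
def permGraph {n : ℕ} (σ : Equiv.Perm (Fin n)) : Finset (Fin n × Fin n) :=
  univ.image fun i => (i, σ i)

theorem mem_permGraph {n : ℕ} {σ : Equiv.Perm (Fin n)} {e : Fin n × Fin n} :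
    e ∈ permGraph σ ↔ σ e.1 = e.2 := by
  obtain ⟨a, b⟩ := e
  simp [permGraph]

theorem permGraph_injective {n : ℕ} : Function.Injective (permGraph (n := n)) := by
  intro σ τ h
  ext i
  have : (i, σ i) ∈ permGraph τ := h ▸ mem_permGraph.2 rfl
  rw [mem_permGraph.1 this]

theorem permGraph_mem_perfectMatchings {n : ℕ} (σ : Equiv.Perm (Fin n)) :
    permGraph σ ∈ perfectMatchings n := by
  refine mem_perfectMatchings.2 ⟨fun e he e' he' hne => ?_, ?_⟩
  · rw [mem_permGraph] at he he'
    have h1 : e.1 ≠ e'.1 := fun h => hne (Prod.ext h (by rw [← he, ← he', h]))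
    exact ⟨h1, fun h => h1 (σ.injective (by rw [he, he', h]))⟩
  · rw [permGraph, card_image_of_injective _ fun i j h => congrArg Prod.fst h]
    simp

theorem exists_permGraph_eq {n : ℕ} {P : Finset (Fin n × Fin n)}
    (hP : P ∈ perfectMatchings n) : ∃ σ, permGraph σ = P := by
  obtain ⟨hm, hc⟩ := mem_perfectMatchings.1 hP
  have hinj : Set.InjOn Prod.fst (P : Set (Fin n × Fin n)) := fun e he e' he' h => by
    by_contra hne
    exact (hm e he e' he' hne).1 h
  have himg : P.image Prod.fst = univ := by
    rw [← card_eq_iff_eq_univ, card_image_of_injOn hinj, hc, Fintype.card_fin]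
  have hex : ∀ i : Fin n, ∃ j, (i, j) ∈ P := fun i => by
    have : i ∈ P.image Prod.fst := himg ▸ mem_univ i
    simpa using this
  choose f hf using hex
  have hfi : Function.Injective f := fun i j h => by
    by_contra hne
    exact (hm _ (hf i) _ (hf j) fun h' => hne (congrArg Prod.fst h')).2 h
  refine ⟨Equiv.ofBijective f (Finite.injective_iff_bijective.1 hfi), ?_⟩
  refine eq_of_subset_of_card_le (fun e he => ?_) ?_
  · rw [mem_permGraph] at he
    have := hf e.1
    rwa [show f e.1 = e.2 from he] at this
  · rw [hc, (mem_perfectMatchings.1 (permGraph_mem_perfectMatchings _)).2]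

theorem card_perfectMatchings (n : ℕ) : (perfectMatchings n).card = n.factorial := by
  have : perfectMatchings n = univ.image permGraph := by
    ext P
    simp only [mem_image, mem_univ, true_and]
    exact ⟨exists_permGraph_eq, fun ⟨σ, h⟩ => h ▸ permGraph_mem_perfectMatchings σ⟩
  rw [this, card_image_of_injective _ permGraph_injective, card_univ, Fintype.card_perm,
    Fintype.card_fin]

/-- A matching with `ℓ` edges lies in at most `(n - ℓ)!` perfect matchings. -/
theorem card_perfectMatchings_filter_superset_le {n : ℕ} {M : Finset (Fin n × Fin n)}
    (hM : IsMatching M) :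
    ((perfectMatchings n).filter (M ⊆ ·)).card ≤ (n - M.card).factorial := by
  classical
  rcases ((perfectMatchings n).filter (M ⊆ ·)).eq_empty_or_nonempty with h | ⟨P₀, hP₀⟩
  · simp [h]
  obtain ⟨hP₀, hMP₀⟩ := mem_filter.1 hP₀
  obtain ⟨σ₀, rfl⟩ := exists_permGraph_eq hP₀
  set S := M.image Prod.fst with hS
  have hSc : S.card = M.card := card_image_of_injOn fun e he e' he' h => by
    by_contra hne
    exact (hM e he e' he' hne).1 h
  have hcard : (univ.filter fun f : Equiv.Perm (Fin n) => ∀ a, ¬ (a ∉ S) → f a = a).card =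
      (n - M.card).factorial := by
    rw [← Fintype.card_subtype,
      ← Fintype.card_congr (Equiv.Perm.subtypeEquivSubtypePerm fun a => a ∉ S),
      Fintype.card_perm, Fintype.card_subtype_compl]
    simp [hSc]
  rw [← hcard]
  refine (card_le_card ?_).trans
    (card_image_le (f := fun f : Equiv.Perm (Fin n) => permGraph (σ₀ * f)))
  intro P hP
  obtain ⟨hP, hMP⟩ := mem_filter.1 hP
  obtain ⟨σ, rfl⟩ := exists_permGraph_eq hP
  refine mem_image.2 ⟨σ₀⁻¹ * σ, mem_filter.2 ⟨mem_univ _, fun a ha => ?_⟩, by simp⟩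
  rw [not_not, hS, mem_image] at ha
  obtain ⟨e, he, rfl⟩ := ha
  rw [Equiv.Perm.mul_apply, mem_permGraph.1 (hMP he), ← mem_permGraph.1 (hMP₀ he)]
  simp

theorem pow_mul_factorial_le_pow_mul_descFactorial {n ℓ : ℕ} (h : ℓ ≤ n) :
    n ^ ℓ * ℓ.factorial ≤ ℓ ^ ℓ * n.descFactorial ℓ := by
  rw [← Nat.descFactorial_self, Nat.descFactorial_eq_prod_range, Nat.descFactorial_eq_prod_range]
  have hconst (a : ℕ) : a ^ ℓ = ∏ _i ∈ range ℓ, a := by rw [prod_const, card_range]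
  rw [hconst n, hconst ℓ, ← prod_mul_distrib, ← prod_mul_distrib]
  refine prod_le_prod' fun i _ => ?_
  rw [Nat.mul_sub, Nat.mul_sub, mul_comm n ℓ]
  exact Nat.sub_le_sub_left (Nat.mul_le_mul_right i h) _

theorem pow_le_exp_pow_mul_descFactorial {n ℓ : ℕ} (h : ℓ ≤ n) :
    (n : ℝ) ^ ℓ ≤ Real.exp 1 ^ ℓ * n.descFactorial ℓ := by
  have hf : (0 : ℝ) < ℓ.factorial := by exact_mod_cast ℓ.factorial_pos
  have h1 : (n : ℝ) ^ ℓ * ℓ.factorial ≤ (ℓ : ℝ) ^ ℓ * n.descFactorial ℓ := by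
    exact_mod_cast pow_mul_factorial_le_pow_mul_descFactorial h
  have h2 : (ℓ : ℝ) ^ ℓ ≤ Real.exp 1 ^ ℓ * ℓ.factorial := by
    have := Real.pow_div_factorial_le_exp (ℓ : ℝ) (Nat.cast_nonneg ℓ) ℓ
    rwa [div_le_iff₀ hf, ← Real.exp_one_pow] at this
  refine le_of_mul_le_mul_right ?_ hf
  calc (n : ℝ) ^ ℓ * ℓ.factorial ≤ (ℓ : ℝ) ^ ℓ * n.descFactorial ℓ := h1
    _ ≤ Real.exp 1 ^ ℓ * ℓ.factorial * n.descFactorial ℓ := by gcongr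
    _ = Real.exp 1 ^ ℓ * n.descFactorial ℓ * ℓ.factorial := by ring

/-- A random perfect matching contains a given `ℓ`-matching with probability at most
`(e / n) ^ ℓ`. -/
theorem card_filter_superset_le_exp_div_pow {n : ℕ} (hn : 0 < n) {M : Finset (Fin n × Fin n)}
    (hM : IsMatching M) :
    (((perfectMatchings n).filter (M ⊆ ·)).card : ℝ) ≤
      (Real.exp 1 / n) ^ M.card * (perfectMatchings n).card := by
  have hn' : (0 : ℝ) < n := by exact_mod_cast hn
  rcases le_or_gt M.card n with h | h
  · refine (Nat.cast_le.2 (card_perfectMatchings_filter_superset_le hM)).trans ?_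
    rw [card_perfectMatchings, div_pow, div_mul_eq_mul_div, le_div_iff₀ (by positivity),
      ← Nat.factorial_mul_descFactorial h, Nat.cast_mul]
    have := mul_le_mul_of_nonneg_left (pow_le_exp_pow_mul_descFactorial h)
      (Nat.cast_nonneg (α := ℝ) (n - M.card).factorial)
    linarith
  · have : (perfectMatchings n).filter (M ⊆ ·) = ∅ := filter_eq_empty_iff.2 fun P hP hMP => by
      have := card_le_card hMP
      rw [(mem_perfectMatchings.1 hP).2] at this
      omega
    rw [this]
    simp only [card_empty, Nat.cast_zero]
    positivity

theorem sum_range_succ_pow_le {x : ℝ} (hx : 2 ≤ x) (w : ℕ) :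
    ∑ ℓ ∈ range (w + 1), x ^ ℓ ≤ 2 * x ^ w := by
  induction w with
  | zero => simp
  | succ w ih =>
    rw [sum_range_succ]
    have : 0 < x ^ w := by positivity
    rw [pow_succ]
    nlinarith

/-- A family of sets is `r`-small if for each `ℓ ≥ 1` it has at most `r ^ ℓ` members of
cardinality `ℓ`. -/
def RSmall {α : Type*} (r : ℝ) (𝓖 : Finset (Finset α)) : Prop :=
  ∀ ℓ : ℕ, 1 ≤ ℓ → ((𝓖.filter fun M => M.card = ℓ).card : ℝ) ≤ r ^ ℓ

theorem RSmall.mono {α : Type*} {r : ℝ} {𝓖 𝓗 : Finset (Finset α)} (h : RSmall r 𝓗)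
    (hs : 𝓖 ⊆ 𝓗) : RSmall r 𝓖 := fun ℓ hℓ =>
  le_trans (by exact_mod_cast card_le_card (filter_subset_filter _ hs)) (h ℓ hℓ)

theorem RSmall.card_le {α : Type*} {r x : ℝ} {𝓖 : Finset (Finset α)} {w : ℕ}
    (h : RSmall r 𝓖) (hw : ∀ M ∈ 𝓖, M.card ≤ w) (hr : 0 ≤ r) (hrx : r ≤ x) (hx : 2 ≤ x) :
    (𝓖.card : ℝ) ≤ 2 * x ^ w := by
  classical
  rw [card_eq_sum_card_fiberwise (f := card) (t := range (w + 1))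
    fun M hM => by simpa [Nat.lt_succ_iff] using hw M hM, Nat.cast_sum]
  refine le_trans (sum_le_sum fun ℓ _ => ?_) (sum_range_succ_pow_le hx w)
  rcases Nat.eq_zero_or_pos ℓ with rfl | hℓ
  · rw [pow_zero, Nat.cast_le_one, card_le_one]
    intro a ha b hb
    rw [card_eq_zero.1 (mem_filter.1 ha).2, card_eq_zero.1 (mem_filter.1 hb).2]
  · exact (h ℓ hℓ).trans (pow_le_pow_left₀ hr hrx ℓ)

/-- Replacing an `ε`-matching sunflower by its core creates acceptance only on an
`ε`-fraction of the odd colourings. -/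
theorem IsMatchingSunflower.card_core_errors_le {n : ℕ} {ε : ℝ}
    {𝓢 : Finset (Finset (Fin n × Fin n))} (h : IsMatchingSunflower n ε 𝓢) (hε : ε < 1) :
    ∃ B : Finset (Fin n ⊕ Fin n → Bool), (B.card : ℝ) ≤ ε * (oddColourings n).card ∧
      ∀ c, OddColouring c → c ∉ B → 𝓢.inf id ⊆ graphOf c → Accepts 𝓢 (graphOf c) := by
  classical
  obtain ⟨-, h⟩ := h
  let p : (Fin n ⊕ Fin n → Bool) → Prop := fun c =>
    ∃ M ∈ 𝓢, ∀ e ∈ M \ 𝓢.inf id, c (Sum.inl e.1) = c (Sum.inr e.2)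
  refine ⟨(oddColourings n).filter fun c => ¬ p c, ?_, fun c hc hcB hK => ?_⟩
  · have hcard : Nat.card {c : Fin n ⊕ Fin n → Bool // OddColouring c ∧ p c} =
        ((oddColourings n).filter p).card := by
      rw [Nat.card_eq_fintype_card, Fintype.card_subtype, oddColourings, filter_filter]
    rw [natCard_oddColouring] at h
    change 1 - ε ≤ (Nat.card {c : Fin n ⊕ Fin n → Bool // OddColouring c ∧ p c} : ℝ) / _ at h
    rw [hcard] at h
    have hpos : (0 : ℝ) < (oddColourings n).card := by
      refine lt_of_le_of_ne (Nat.cast_nonneg _) fun h0 => ?_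
      rw [← h0, div_zero] at h
      linarith
    rw [le_div_iff₀ hpos] at h
    have := card_filter_add_card_filter_not (s := oddColourings n) p
    have : (((oddColourings n).filter p).card : ℝ) +
      ((oddColourings n).filter fun c => ¬ p c).card = (oddColourings n).card := by
      exact_mod_cast this
    linarith
  · have hp : p c := by
      by_contra hp
      exact hcB (mem_filter.2 ⟨mem_oddColourings.2 hc, hp⟩)
    obtain ⟨M, hM, hMc⟩ := hp
    refine ⟨M, hM, fun e he => ?_⟩
    by_cases heK : e ∈ 𝓢.inf id
    · exact hK heK
    · simpa [graphOf] using hMc e (mem_sdiff.2 ⟨he, heK⟩)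

/-- Every sufficiently large family of `ℓ`-matchings with `1 ≤ ℓ ≤ k` contains an
`ε`-matching sunflower. -/
def SunflowerBound (n k : ℕ) (ε r : ℝ) : Prop :=
  ∀ ℓ : ℕ, 1 ≤ ℓ → ℓ ≤ k → ∀ 𝓕 : Finset (Finset (Fin n × Fin n)),
    (∀ M ∈ 𝓕, IsMatching M ∧ M.card = ℓ) → r ^ ℓ < (𝓕.card : ℝ) →
    ∃ 𝓢 ⊆ 𝓕, IsMatchingSunflower n ε 𝓢

/-- Repeatedly replacing sunflowers by their cores makes a family of matchings `r`-small. -/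
theorem SunflowerBound.exists_rSmall {n k : ℕ} {ε r : ℝ} (hsun : SunflowerBound n k ε r)
    (hε0 : 0 ≤ ε) (hε : ε < 1) (hr : 0 ≤ r) (𝓕 : Finset (Finset (Fin n × Fin n)))
    (h𝓕 : ∀ M ∈ 𝓕, IsMatching M ∧ M.card ≤ k) :
    ∃ (𝓗 : Finset (Finset (Fin n × Fin n))) (B : Finset (Fin n ⊕ Fin n → Bool)),
      (∀ M ∈ 𝓗, IsMatching M ∧ M.card ≤ k) ∧ RSmall r 𝓗 ∧
      (B.card : ℝ) ≤ 𝓕.card * (ε * (oddColourings n).card) ∧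
      (∀ x, Accepts 𝓕 x → Accepts 𝓗 x) ∧
      ∀ c, OddColouring c → c ∉ B → Accepts 𝓗 (graphOf c) → Accepts 𝓕 (graphOf c) := by
  classical
  induction hm : 𝓕.card using Nat.strong_induction_on generalizing 𝓕 with
  | _ m ih =>
  subst hm
  by_cases hsmall : RSmall r 𝓕
  · exact ⟨𝓕, ∅, h𝓕, hsmall, by simp only [card_empty, Nat.cast_zero]; positivity,
      fun _ h => h, fun _ _ _ h => h⟩
  simp only [RSmall, not_forall, not_le] at hsmall
  obtain ⟨ℓ, hℓ, hlarge⟩ := hsmall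
  have hℓk : ℓ ≤ k := by
    by_contra hlt
    have : 𝓕.filter (fun M => M.card = ℓ) = ∅ := filter_eq_empty_iff.2 fun M hM h => by
      have := (h𝓕 M hM).2
      omega
    rw [this, card_empty, Nat.cast_zero] at hlarge
    exact absurd hlarge (not_lt.2 (by positivity))
  obtain ⟨𝓢, h𝓢, hS⟩ := hsun ℓ hℓ hℓk (𝓕.filter fun M => M.card = ℓ)
    (fun M hM => ⟨(h𝓕 M (mem_filter.1 hM).1).1, (mem_filter.1 hM).2⟩) hlarge
  have h𝓢𝓕 : 𝓢 ⊆ 𝓕 := h𝓢.trans (filter_subset _ _)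
  obtain ⟨B₀, hB₀, hcore⟩ := hS.card_core_errors_le hε
  have hKsub : ∀ M ∈ 𝓢, 𝓢.inf id ⊆ M := fun M hM => Finset.inf_le (f := id) hM
  set K := 𝓢.inf id with hK
  have h2 := hS.1
  have hcard : (insert K (𝓕 \ 𝓢)).card < 𝓕.card := by
    have h3 := card_insert_le K (𝓕 \ 𝓢)
    have h4 := card_sdiff_add_card_eq_card h𝓢𝓕
    omega
  obtain ⟨M₀, hM₀⟩ : 𝓢.Nonempty := card_pos.1 (by omega)
  obtain ⟨𝓗, B, h𝓗, hs, hB, hpos, hneg⟩ := ih _ hcard (insert K (𝓕 \ 𝓢)) (by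
    intro M hM
    rcases mem_insert.1 hM with rfl | hM
    · obtain ⟨hm, hc⟩ := h𝓕 M₀ (h𝓢𝓕 hM₀)
      exact ⟨hm.subset (hKsub _ hM₀), (card_le_card (hKsub _ hM₀)).trans hc⟩
    · exact h𝓕 M (mem_sdiff.1 hM).1) rfl
  refine ⟨𝓗, B ∪ B₀, h𝓗, hs, ?_, fun x ⟨M, hM, hMx⟩ => hpos x ?_, fun c hc hcB hacc => ?_⟩
  · have h5 : ((B ∪ B₀).card : ℝ) ≤ B.card + B₀.card := by exact_mod_cast card_union_le B B₀
    have h6 : ((insert K (𝓕 \ 𝓢)).card : ℝ) + 1 ≤ 𝓕.card := by exact_mod_cast hcard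
    have h7 : 0 ≤ ε * ((oddColourings n).card : ℝ) := by positivity
    nlinarith
  · by_cases hMS : M ∈ 𝓢
    · exact ⟨K, mem_insert_self _ _, (hKsub M hMS).trans hMx⟩
    · exact ⟨M, mem_insert_of_mem (mem_sdiff.2 ⟨hM, hMS⟩), hMx⟩
  · rw [mem_union, not_or] at hcB
    obtain ⟨M, hM, hMc⟩ := hneg c hc hcB.1 hacc
    rcases mem_insert.1 hM with rfl | hM
    · obtain ⟨M', hM', h'⟩ := hcore c hc hcB.2 hMc
      exact ⟨M', h𝓢𝓕 hM', h'⟩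
    · exact ⟨M, (mem_sdiff.1 hM).1, hMc⟩

/-- Few perfect matchings contain a member, larger than `w`, of an `r`-small family. -/
theorem RSmall.card_filter_accepts_le {n w : ℕ} {r : ℝ} (hn : 0 < n) (hr : 0 ≤ r)
    (hrn : Real.exp 1 * r / n ≤ 1 / 2) {𝓗 : Finset (Finset (Fin n × Fin n))}
    (h𝓗 : ∀ M ∈ 𝓗, IsMatching M) (hs : RSmall r 𝓗) :
    ∃ B : Finset (Finset (Fin n × Fin n)),
      (B.card : ℝ) ≤ 2 * (Real.exp 1 * r / n) ^ w * (perfectMatchings n).card ∧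
      ∀ P ∈ perfectMatchings n, P ∉ B → Accepts 𝓗 P →
        Accepts (𝓗.filter fun M => M.card ≤ w) P := by
  classical
  set q := Real.exp 1 * r / n with hq
  have hq0 : 0 ≤ q := by positivity
  set N : ℝ := ((perfectMatchings n).card : ℝ)
  set 𝓛 := 𝓗.filter fun M => w < M.card with h𝓛
  refine ⟨𝓛.biUnion fun M => (perfectMatchings n).filter (M ⊆ ·), ?_, ?_⟩
  · obtain ⟨k, hk⟩ : ∃ k, ∀ M ∈ 𝓛, M.card < w + k :=
      ⟨𝓛.sup card + 1, fun M hM => by have := le_sup (f := card) hM; omega⟩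
    calc ((𝓛.biUnion fun M => (perfectMatchings n).filter (M ⊆ ·)).card : ℝ)
        ≤ ∑ M ∈ 𝓛, (((perfectMatchings n).filter (M ⊆ ·)).card : ℝ) := by
          exact_mod_cast card_biUnion_le
      _ ≤ ∑ M ∈ 𝓛, (Real.exp 1 / n) ^ M.card * N := sum_le_sum fun M hM =>
          card_filter_superset_le_exp_div_pow hn (h𝓗 M (mem_filter.1 hM).1)
      _ = ∑ ℓ ∈ Ico w (w + k), ∑ M ∈ 𝓛 with M.card = ℓ, (Real.exp 1 / n) ^ M.card * N :=
          (sum_fiberwise_of_maps_to (fun M hM => mem_Ico.2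
            ⟨(mem_filter.1 hM).2.le, hk M hM⟩) _).symm
      _ ≤ ∑ ℓ ∈ Ico w (w + k), q ^ ℓ * N := by
          refine sum_le_sum fun ℓ _ => ?_
          rw [sum_congr rfl fun M hM => by rw [(mem_filter.1 hM).2], sum_const, nsmul_eq_mul]
          rcases Nat.eq_zero_or_pos ℓ with rfl | hℓ
          · have : 𝓛.filter (fun M => M.card = 0) = ∅ := filter_eq_empty_iff.2 fun M hM h => by
              have := (mem_filter.1 hM).2
              omega
            rw [this, card_empty, Nat.cast_zero, zero_mul]
            positivity
          · rw [← mul_assoc]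
            refine mul_le_mul_of_nonneg_right ?_ (Nat.cast_nonneg _)
            calc _ ≤ r ^ ℓ * (Real.exp 1 / n) ^ ℓ := by
                  gcongr
                  exact hs.mono (filter_subset _ _) ℓ hℓ
              _ = q ^ ℓ := by rw [← mul_pow, hq]; congr 1; ring
      _ = q ^ w * (∑ j ∈ range k, q ^ j) * N := by
          rw [← sum_mul, sum_Ico_eq_sum_range, mul_sum, Nat.add_sub_cancel_left]
          simp only [pow_add]
      _ ≤ q ^ w * 2 * N := by
          gcongr
          exact (sum_le_sum fun j _ => pow_le_pow_left₀ hq0 hrn j).trans (sum_geometric_two_le k)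
      _ = 2 * q ^ w * N := by ring
  · rintro P hP hPB ⟨M, hM, hMP⟩
    refine ⟨M, mem_filter.2 ⟨hM, ?_⟩, hMP⟩
    by_contra hlt
    exact hPB (mem_biUnion.2 ⟨M, mem_filter.2 ⟨hM, not_le.1 hlt⟩, mem_filter.2 ⟨hP, hMP⟩⟩)

/-- The families used as approximators: `r`-small families of matchings of size at most `w`. -/
def IsApproximator {n : ℕ} (w : ℕ) (r : ℝ) (𝓖 : Finset (Finset (Fin n × Fin n))) : Prop :=
  (∀ M ∈ 𝓖, IsMatching M ∧ M.card ≤ w) ∧ RSmall r 𝓖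

/-- Matchings that are unions of a member of `𝓐` and a member of `𝓑`. -/
noncomputable def conjFamily {n : ℕ} (𝓐 𝓑 : Finset (Finset (Fin n × Fin n))) :
    Finset (Finset (Fin n × Fin n)) :=
  open Classical in ((𝓐 ×ˢ 𝓑).image fun p => p.1 ∪ p.2).filter IsMatching

theorem accepts_union {n : ℕ} {𝓐 𝓑 : Finset (Finset (Fin n × Fin n))}
    {x : Finset (Fin n × Fin n)} : Accepts (𝓐 ∪ 𝓑) x ↔ Accepts 𝓐 x ∨ Accepts 𝓑 x := by
  simp only [Accepts, mem_union, or_and_right, exists_or]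

theorem Accepts.of_conjFamily {n : ℕ} {𝓐 𝓑 : Finset (Finset (Fin n × Fin n))}
    {x : Finset (Fin n × Fin n)} (h : Accepts (conjFamily 𝓐 𝓑) x) :
    Accepts 𝓐 x ∧ Accepts 𝓑 x := by
  classical
  obtain ⟨M, hM, hMx⟩ := h
  obtain ⟨⟨A, B⟩, hAB, rfl⟩ := mem_image.1 (mem_filter.1 hM).1
  obtain ⟨hA, hB⟩ := mem_product.1 hAB
  exact ⟨⟨A, hA, subset_union_left.trans hMx⟩, ⟨B, hB, subset_union_right.trans hMx⟩⟩

theorem Accepts.conjFamily {n : ℕ} {𝓐 𝓑 : Finset (Finset (Fin n × Fin n))}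
    {x : Finset (Fin n × Fin n)} (hx : IsMatching x) (hA : Accepts 𝓐 x) (hB : Accepts 𝓑 x) :
    Accepts (conjFamily 𝓐 𝓑) x := by
  classical
  obtain ⟨A, hA, hAx⟩ := hA
  obtain ⟨B, hB, hBx⟩ := hB
  have hsub : A ∪ B ⊆ x := union_subset hAx hBx
  exact ⟨A ∪ B, mem_filter.2 ⟨mem_image.2 ⟨(A, B), mem_product.2 ⟨hA, hB⟩, rfl⟩,
    hx.subset hsub⟩, hsub⟩

/-- Numerical hypotheses on the parameters of the approximation. -/
structure ApproxParams (n w : ℕ) (ε r : ℝ) : Prop where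
  two_le : 2 ≤ n
  one_le_w : 1 ≤ w
  ε_nonneg : 0 ≤ ε
  ε_lt_one : ε < 1
  one_le_r : 1 ≤ r
  ratio_le : Real.exp 1 * r / (n : ℝ) ≤ 1 / 2
  sunflower : SunflowerBound n (2 * w) ε r

namespace ApproxParams

variable {n w : ℕ} {ε r : ℝ}

theorem r_le (H : ApproxParams n w ε r) : r ≤ n := by
  have hn : (0 : ℝ) < n := by exact_mod_cast lt_of_lt_of_le two_pos H.two_le
  have h := H.ratio_le
  rw [div_le_iff₀ hn] at h
  have h1 : (1 : ℝ) ≤ Real.exp 1 := Real.one_le_exp zero_le_one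
  nlinarith [H.one_le_r]

theorem card_le (H : ApproxParams n w ε r) {𝓖 : Finset (Finset (Fin n × Fin n))}
    (h : IsApproximator w r 𝓖) : (𝓖.card : ℝ) ≤ 2 * (n : ℝ) ^ w :=
  h.2.card_le (fun M hM => (h.1 M hM).2) (zero_le_one.trans H.one_le_r) H.r_le
    (by exact_mod_cast H.two_le)

/-- A family of matchings of size at most `2 * w` can be replaced by an approximator with
small error. -/
theorem exists_approximator (H : ApproxParams n w ε r) (𝓕 : Finset (Finset (Fin n × Fin n)))
    (h𝓕 : ∀ M ∈ 𝓕, IsMatching M ∧ M.card ≤ 2 * w)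
    (hcard : (𝓕.card : ℝ) ≤ 4 * (n : ℝ) ^ (4 * w)) :
    ∃ (𝓖 : Finset (Finset (Fin n × Fin n))) (B : Finset (Fin n ⊕ Fin n → Bool))
      (B' : Finset (Finset (Fin n × Fin n))), IsApproximator w r 𝓖 ∧
      (B.card : ℝ) ≤ 4 * (n : ℝ) ^ (4 * w) * ε * (oddColourings n).card ∧
      (B'.card : ℝ) ≤ 4 * (Real.exp 1 * r / n) ^ w * (perfectMatchings n).card ∧
      (∀ c, OddColouring c → c ∉ B → Accepts 𝓖 (graphOf c) → Accepts 𝓕 (graphOf c)) ∧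
      ∀ P ∈ perfectMatchings n, P ∉ B' → Accepts 𝓕 P → Accepts 𝓖 P := by
  have hr : 0 ≤ r := zero_le_one.trans H.one_le_r
  have hε := H.ε_nonneg
  obtain ⟨𝓗, B, h𝓗, hs, hB, hpos, hneg⟩ :=
    H.sunflower.exists_rSmall H.ε_nonneg H.ε_lt_one hr 𝓕 h𝓕
  obtain ⟨B', hB', hbig⟩ := hs.card_filter_accepts_le (w := w)
    (lt_of_lt_of_le two_pos H.two_le) hr H.ratio_le fun M hM => (h𝓗 M hM).1
  refine ⟨𝓗.filter fun M => M.card ≤ w, B, B', ⟨fun M hM => ⟨(h𝓗 M (mem_filter.1 hM).1).1,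
    (mem_filter.1 hM).2⟩, hs.mono (filter_subset _ _)⟩, ?_, ?_,
    fun c hc hcB ⟨M, hM, hMc⟩ => hneg c hc hcB ⟨M, (mem_filter.1 hM).1, hMc⟩,
    fun P hP hPB h => hbig P hP hPB (hpos P h)⟩
  · rw [mul_assoc]
    exact hB.trans (by gcongr)
  · refine hB'.trans ?_
    gcongr
    norm_num

theorem union_bounds (H : ApproxParams n w ε r)
    {𝓐 𝓑 : Finset (Finset (Fin n × Fin n))} (hA : IsApproximator w r 𝓐)
    (hB : IsApproximator w r 𝓑) :
    (∀ M ∈ 𝓐 ∪ 𝓑, IsMatching M ∧ M.card ≤ 2 * w) ∧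
      ((𝓐 ∪ 𝓑).card : ℝ) ≤ 4 * (n : ℝ) ^ (4 * w) := by
  have hn : (1 : ℝ) ≤ n := by exact_mod_cast one_le_two.trans H.two_le
  refine ⟨fun M hM => ?_, ?_⟩
  · rcases mem_union.1 hM with hM | hM
    · exact ⟨(hA.1 M hM).1, by have := (hA.1 M hM).2; omega⟩
    · exact ⟨(hB.1 M hM).1, by have := (hB.1 M hM).2; omega⟩
  · have h1 : ((𝓐 ∪ 𝓑).card : ℝ) ≤ 𝓐.card + 𝓑.card := by exact_mod_cast card_union_le 𝓐 𝓑
    have h2 : (n : ℝ) ^ w ≤ (n : ℝ) ^ (4 * w) := pow_le_pow_right₀ hn (by omega)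
    linarith [H.card_le hA, H.card_le hB]

theorem conjFamily_bounds (H : ApproxParams n w ε r)
    {𝓐 𝓑 : Finset (Finset (Fin n × Fin n))} (hA : IsApproximator w r 𝓐)
    (hB : IsApproximator w r 𝓑) :
    (∀ M ∈ conjFamily 𝓐 𝓑, IsMatching M ∧ M.card ≤ 2 * w) ∧
      ((conjFamily 𝓐 𝓑).card : ℝ) ≤ 4 * (n : ℝ) ^ (4 * w) := by
  classical
  have hn : (1 : ℝ) ≤ n := by exact_mod_cast one_le_two.trans H.two_le
  refine ⟨fun M hM => ?_, ?_⟩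
  · obtain ⟨himg, hm⟩ := mem_filter.1 hM
    obtain ⟨⟨S, T⟩, hST, rfl⟩ := mem_image.1 himg
    obtain ⟨hS, hT⟩ := mem_product.1 hST
    refine ⟨hm, ?_⟩
    have h1 := card_union_le S T
    have h2 := (hA.1 S hS).2
    have h3 := (hB.1 T hT).2
    simp only
    omega
  · have h1 : ((conjFamily 𝓐 𝓑).card : ℝ) ≤ 𝓐.card * 𝓑.card := by
      rw [← Nat.cast_mul, ← card_product]
      exact_mod_cast (card_filter_le _ _).trans card_image_le
    calc ((conjFamily 𝓐 𝓑).card : ℝ) ≤ 𝓐.card * 𝓑.card := h1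
      _ ≤ (2 * (n : ℝ) ^ w) * (2 * (n : ℝ) ^ w) := by
          gcongr
          · exact H.card_le hA
          · exact H.card_le hB
      _ = 4 * (n : ℝ) ^ (2 * w) := by ring
      _ ≤ 4 * (n : ℝ) ^ (4 * w) := by
          gcongr
          norm_num

theorem isApproximator_singleton (H : ApproxParams n w ε r) (e : Fin n × Fin n) :
    IsApproximator w r {{e}} := by
  refine ⟨fun M hM => ?_, fun ℓ _ => ?_⟩
  · rw [mem_singleton.1 hM]
    refine ⟨fun a ha b hb hab => ?_, by simpa using H.one_le_w⟩
    rw [mem_singleton] at ha hb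
    exact absurd (ha.trans hb.symm) hab
  · have h1 : ((({{e}} : Finset (Finset (Fin n × Fin n))).filter
        fun M => M.card = ℓ).card : ℝ) ≤ 1 := by
      exact_mod_cast (card_filter_le _ _).trans (card_singleton _).le
    exact h1.trans (one_le_pow₀ H.one_le_r)

end ApproxParams

/-- The input bit vector of a graph. -/
def bits {n : ℕ} (x : Finset (Fin n × Fin n)) : Fin n × Fin n → Bool := fun e => decide (e ∈ x)

/-- The first `k` gates of a monotone circuit can be approximated with errors at most
`k` times the error of a single gate. -/
theorem ApproxParams.exists_gate_approximators {n w : ℕ} {ε r : ℝ}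
    (H : ApproxParams n w ε r) (C : MonCircuit (Fin n × Fin n)) (k : ℕ) (hk : k ≤ C.size) :
    ∃ (𝓖 : ℕ → Finset (Finset (Fin n × Fin n))) (B : Finset (Fin n ⊕ Fin n → Bool))
      (B' : Finset (Finset (Fin n × Fin n))),
      (B.card : ℝ) ≤ k * (4 * (n : ℝ) ^ (4 * w) * ε * (oddColourings n).card) ∧
      (B'.card : ℝ) ≤ k * (4 * (Real.exp 1 * r / n) ^ w * (perfectMatchings n).card) ∧
      ∀ i (hi : i < k), IsApproximator w r (𝓖 i) ∧
        (∀ c, OddColouring c → c ∉ B → Accepts (𝓖 i) (graphOf c) →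
          C.eval (bits (graphOf c)) ⟨i, hi.trans_le hk⟩ = true) ∧
        ∀ P ∈ perfectMatchings n, P ∉ B' → C.eval (bits P) ⟨i, hi.trans_le hk⟩ = true →
          Accepts (𝓖 i) P := by
  classical
  induction k with
  | zero => exact ⟨fun _ => ∅, ∅, ∅, by simp, by simp, fun i hi => absurd hi (Nat.not_lt_zero i)⟩
  | succ k ih =>
  obtain ⟨𝓖, B, B', hB, hB', h𝓖⟩ := ih (by omega)
  have hr : 0 ≤ r := zero_le_one.trans H.one_le_r
  have hε := H.ε_nonneg
  -- It suffices to approximate gate `k` relative to the approximators of the earlier gates.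
  suffices hgate : ∃ (𝓝 : Finset (Finset (Fin n × Fin n))) (D : Finset (Fin n ⊕ Fin n → Bool))
      (D' : Finset (Finset (Fin n × Fin n))), IsApproximator w r 𝓝 ∧
      (D.card : ℝ) ≤ 4 * (n : ℝ) ^ (4 * w) * ε * (oddColourings n).card ∧
      (D'.card : ℝ) ≤ 4 * (Real.exp 1 * r / n) ^ w * (perfectMatchings n).card ∧
      (∀ c, OddColouring c → c ∉ B → c ∉ D → Accepts 𝓝 (graphOf c) →
        C.eval (bits (graphOf c)) ⟨k, hk⟩ = true) ∧
      ∀ P ∈ perfectMatchings n, P ∉ B' → P ∉ D' → C.eval (bits P) ⟨k, hk⟩ = true →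
        Accepts 𝓝 P by
    obtain ⟨𝓝, D, D', h𝓝, hD, hD', hneg, hpos⟩ := hgate
    refine ⟨Function.update 𝓖 k 𝓝, B ∪ D, B' ∪ D', ?_, ?_, fun i hi => ?_⟩
    · have : ((B ∪ D).card : ℝ) ≤ B.card + D.card := by exact_mod_cast card_union_le B D
      push_cast
      linarith
    · have : ((B' ∪ D').card : ℝ) ≤ B'.card + D'.card := by exact_mod_cast card_union_le B' D'
      push_cast
      linarith
    simp only [mem_union, not_or]
    rcases Nat.lt_succ_iff_lt_or_eq.1 hi with hlt | rfl
    · rw [Function.update_of_ne hlt.ne]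
      obtain ⟨h1, h2, h3⟩ := h𝓖 i hlt
      exact ⟨h1, fun c hc hcB => h2 c hc hcB.1, fun P hP hPB => h3 P hP hPB.1⟩
    · rw [Function.update_self]
      exact ⟨h𝓝, fun c hc hcB => hneg c hc hcB.1 hcB.2, fun P hP hPB => hpos P hP hPB.1 hPB.2⟩
  have heval : ∀ x, C.eval x ⟨k, hk⟩ = match C.gate ⟨k, hk⟩ with
      | Sum.inl j => x j
      | Sum.inr (op, j, l) =>
        if op then C.eval x ⟨j.val, j.isLt.trans hk⟩ && C.eval x ⟨l.val, l.isLt.trans hk⟩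
        else C.eval x ⟨j.val, j.isLt.trans hk⟩ || C.eval x ⟨l.val, l.isLt.trans hk⟩ := by
    intro x
    rw [MonCircuit.eval]
    rcases C.gate ⟨k, hk⟩ with e | ⟨op, j, l⟩ <;> rfl
  simp only [heval]
  rcases C.gate ⟨k, hk⟩ with e | ⟨op, j, l⟩
  · refine ⟨{{e}}, ∅, ∅, H.isApproximator_singleton e, ?_, ?_, ?_, ?_⟩
    · simp only [card_empty, Nat.cast_zero]
      positivity
    · simp only [card_empty, Nat.cast_zero]
      positivity
    · intro c _ _ _ h
      simpa [Accepts, bits] using h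
    · intro P _ _ _ h
      simpa [Accepts, bits] using h
  · obtain ⟨hj, hjneg, hjpos⟩ := h𝓖 j j.isLt
    obtain ⟨hl, hlneg, hlpos⟩ := h𝓖 l l.isLt
    cases op with
    | true =>
      obtain ⟨hm, hc⟩ := H.conjFamily_bounds hj hl
      obtain ⟨𝓝, D, D', h𝓝, hD, hD', hneg, hpos⟩ := H.exists_approximator _ hm hc
      refine ⟨𝓝, D, D', h𝓝, hD, hD', fun c hc hcB hcD h => ?_, fun P hP hPB hPD h => ?_⟩
      · have := (hneg c hc hcD h).of_conjFamily
        simp [hjneg c hc hcB this.1, hlneg c hc hcB this.2]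
      · simp only [if_true, Bool.and_eq_true] at h
        exact hpos P hP hPD (Accepts.conjFamily (mem_perfectMatchings.1 hP).1
          (hjpos P hP hPB h.1) (hlpos P hP hPB h.2))
    | false =>
      obtain ⟨hm, hc⟩ := H.union_bounds hj hl
      obtain ⟨𝓝, D, D', h𝓝, hD, hD', hneg, hpos⟩ := H.exists_approximator _ hm hc
      refine ⟨𝓝, D, D', h𝓝, hD, hD', fun c hc hcB hcD h => ?_, fun P hP hPB hPD h => ?_⟩
      · rcases accepts_union.1 (hneg c hc hcD h) with h | h
        · simp [hjneg c hc hcB h]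
        · simp [hlneg c hc hcB h]
      · simp only [Bool.false_eq_true, if_false, Bool.or_eq_true] at h
        exact hpos P hP hPD (accepts_union.2 (h.imp (hjpos P hP hPB) (hlpos P hP hPB)))

/-- Approximation of a monotone circuit for matching by a small DNF of matchings:
if a monotone circuit of size `s` accepts every perfect matching of `K_{n,n}` and rejects
`x(c)` for every odd colouring `c`, then (under the matching-sunflower hypothesis for the
parameters `(r, ε)`) there is an `r`-small family `𝓖` of matchings of size at most `w` with
`(1/2)·Pr_{c odd}[F_𝓖(x(c)) = 1] + (1/2)·Pr_{P}[F_𝓖(P) = 0]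
  ≤ s · (2·n^{4w}·ε + 2·(e·r/n)^w)`. -/
theorem circuit_approximated_by_small_dnf (n w : ℕ) (hn : 2 ≤ n) (hw : 1 ≤ w)
    (ε r : ℝ) (hε0 : 0 < ε) (hε1 : ε < 1) (hr : 1 ≤ r)
    (hrn : Real.exp 1 * r / (n : ℝ) ≤ 1 / 2)
    (hsun : ∀ ℓ : ℕ, 1 ≤ ℓ → ℓ ≤ 2 * w →
      ∀ 𝓕 : Finset (Finset (Fin n × Fin n)),
        (∀ M ∈ 𝓕, IsMatching M ∧ M.card = ℓ) → r ^ ℓ < (𝓕.card : ℝ) →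
        ∃ 𝓕' ⊆ 𝓕, IsMatchingSunflower n ε 𝓕')
    (C : MonCircuit (Fin n × Fin n)) (hC : 0 < C.size)
    (hyes : ∀ P : Finset (Fin n × Fin n), IsMatching P → P.card = n →
      C.eval (fun e => decide (e ∈ P)) ⟨C.size - 1, Nat.sub_lt hC Nat.one_pos⟩ = true)
    (hno : ∀ c : Fin n ⊕ Fin n → Bool, OddColouring c →
      C.eval (fun e => decide (c (Sum.inl e.1) = c (Sum.inr e.2)))
        ⟨C.size - 1, Nat.sub_lt hC Nat.one_pos⟩ = false) :
    ∃ 𝓖 : Finset (Finset (Fin n × Fin n)),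
      (∀ M ∈ 𝓖, IsMatching M ∧ M.card ≤ w) ∧
      (∀ ℓ : ℕ, 1 ≤ ℓ → ((𝓖.filter (fun M => M.card = ℓ)).card : ℝ) ≤ r ^ ℓ) ∧
      (1 / 2 : ℝ) *
          ((Nat.card {c : Fin n ⊕ Fin n → Bool // OddColouring c ∧
              ∃ M ∈ 𝓖, M ⊆ graphOf c} : ℝ) /
            (Nat.card {c : Fin n ⊕ Fin n → Bool // OddColouring c} : ℝ)) +
        (1 / 2 : ℝ) *
          ((Nat.card {P : Finset (Fin n × Fin n) // (IsMatching P ∧ P.card = n) ∧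
              ¬ ∃ M ∈ 𝓖, M ⊆ P} : ℝ) /
            (Nat.card {P : Finset (Fin n × Fin n) // IsMatching P ∧ P.card = n} : ℝ))
        ≤ (C.size : ℝ) *
            (2 * (n : ℝ) ^ (4 * w) * ε + 2 * (Real.exp 1 * r / (n : ℝ)) ^ w) := by
  have H : ApproxParams n w ε r := ⟨hn, hw, hε0.le, hε1, hr, hrn, hsun⟩
  obtain ⟨𝓖, B, B', hB, hB', h𝓖⟩ := H.exists_gate_approximators C C.size le_rfl
  obtain ⟨⟨hG, hs⟩, hneg, hpos⟩ := h𝓖 (C.size - 1) (Nat.sub_lt hC Nat.one_pos)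
  have hr0 : 0 ≤ r := zero_le_one.trans hr
  refine ⟨𝓖 (C.size - 1), hG, hs, ?_⟩
  have hbadB : ∀ c : Fin n ⊕ Fin n → Bool,
      (OddColouring c ∧ ∃ M ∈ 𝓖 (C.size - 1), M ⊆ graphOf c) → c ∈ B := by
    rintro c ⟨hc, hacc⟩
    by_contra hcB
    have h1 := hneg c hc hcB hacc
    have h2 : bits (graphOf c) = fun e => decide (c (Sum.inl e.1) = c (Sum.inr e.2)) := by
      funext e
      simp [bits, graphOf]
    rw [h2, hno c hc] at h1
    exact Bool.false_ne_true h1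
  have hbadB' : ∀ P : Finset (Fin n × Fin n), ((IsMatching P ∧ P.card = n) ∧
      ¬ ∃ M ∈ 𝓖 (C.size - 1), M ⊆ P) → P ∈ B' := by
    rintro P ⟨hP, hrej⟩
    by_contra hPB
    exact hrej (hpos P (mem_perfectMatchings.2 hP) hPB (hyes P hP.1 hP.2))
  rw [natCard_oddColouring, natCard_perfectMatching]
  have h1 := div_le_of_le_mul₀ (Nat.cast_nonneg (oddColourings n).card)
    (c := C.size * (4 * (n : ℝ) ^ (4 * w) * ε)) (by positivity)
    ((Nat.cast_le.2 (natCard_subtype_le_card hbadB)).trans (hB.trans_eq (mul_assoc _ _ _).symm))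
  have h2 := div_le_of_le_mul₀ (Nat.cast_nonneg (perfectMatchings n).card)
    (c := C.size * (4 * (Real.exp 1 * r / n) ^ w)) (by positivity)
    ((Nat.cast_le.2 (natCard_subtype_le_card hbadB')).trans (hB'.trans_eq (mul_assoc _ _ _).symm))
  linarith
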